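/- arXiv:2601.08110 — 4 statements merged into one kernel-verified Lean document; each statement's English description precedes it below -/
import Mathlib

section
/- Let R be a real block upper-triangular matrix R = [[R_UU, R_US], [0, R_SS]] where R_UU is an invertible k×k matrix, R_US is k×s, and R_SS is s×s, and let b = (b_U, b_S) with b_U ∈ ℝ^k, b_S ∈ ℝ^s. For a vector d = (0, d_S) whose static block is zero, the following are equivalent: (i) (RᵀR) d = b; (ii) setting y_U := R_US d_S, one has R_UUᵀ y_U = b_U and (R_SSᵀ R_SS) d_S = b_S − R_USᵀ y_U. -/
open Matrix

/-- For the block upper-triangular factor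
`R = [[R_UU, R_US], [0, R_SS]]` with `R_UU` invertible, and `b = (b_U, b_S)`,
a vector `d = (0, d_S)` with zero static block satisfies the normal equations
`(Rᵀ R) d = b` iff, with `y_U := R_US d_S`, we have `R_UUᵀ y_U = b_U` and
`(R_SSᵀ R_SS) d_S = b_S − R_USᵀ y_U`. -/
theorem selective_partial_solve_iff
    {k s : ℕ} (RUU : Matrix (Fin k) (Fin k) ℝ) (RUS : Matrix (Fin k) (Fin s) ℝ)
    (RSS : Matrix (Fin s) (Fin s) ℝ) (hUU : IsUnit RUU)
    (bU : Fin k → ℝ) (bS : Fin s → ℝ) (dS : Fin s → ℝ) :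
    ((Matrix.fromBlocks RUU RUS 0 RSS)ᵀ * Matrix.fromBlocks RUU RUS 0 RSS).mulVec
        (Sum.elim 0 dS) = Sum.elim bU bS ↔
      (RUUᵀ.mulVec (RUS.mulVec dS) = bU ∧
        (RSSᵀ * RSS).mulVec dS = bS - RUSᵀ.mulVec (RUS.mulVec dS)) := by
  rw [fromBlocks_transpose, fromBlocks_multiply, fromBlocks_mulVec, Sum.elim_eq_iff]
  simp only [Sum.elim_comp_inl, Sum.elim_comp_inr, mulVec_zero, zero_add, transpose_zero,
    Matrix.zero_mul, add_zero, add_mulVec, mulVec_mulVec, eq_sub_iff_add_eq']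
end

section
/- Let c : ℝⁿ → ℝ be differentiable and bounded below, and let α > 0 and τ_d > 0. Let (x_t)_{t∈ℕ} be a sequence, and for each t let S_t ⊆ {1,…,n} be an active set containing every coordinate whose partial derivative is large: S_t ⊇ { i : |∂_i c(x_t)| > τ_d }. Suppose each step achieves the block sufficient decrease c(x_{t+1}) ≤ c(x_t) − α ∑_{i ∈ S_t} (∂_i c(x_t))². Then the set of iterations at which the gradient is not uniformly small, T := { t : ‖∇c(x_t)‖_∞ > τ_d }, is finite, and its cardinality is at most (c(x_0) − inf c)/(α τ_d²). -/
open Filter Topology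

/-- A nonincreasing real sequence bounded below by `m` that drops by at least `δ > 0` at every time
in `T` forces `T` to be finite, with at most `(f 0 - m) / δ` elements. -/
theorem finite_and_ncard_le_of_forall_mem_drop {f : ℕ → ℝ} {m δ : ℝ} {T : Set ℕ} (hδ : 0 < δ)
    (hm : ∀ t, m ≤ f t) (hf : Antitone f) (hT : ∀ t ∈ T, f (t + 1) ≤ f t - δ) :
    T.Finite ∧ (T.ncard : ℝ) ≤ (f 0 - m) / δ := by
  classical
  have telescope (F : Finset ℕ) (hF : ↑F ⊆ T) (N : ℕ) :
      ((F.filter (· < N)).card : ℝ) * δ ≤ f 0 - f N := by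
    induction N with
    | zero => simp
    | succ N ih =>
      by_cases hN : N ∈ F
      · have hfilter : F.filter (· < N + 1) = insert N (F.filter (· < N)) := by
          ext t
          simp only [Finset.mem_filter, Finset.mem_insert]
          grind
        rw [hfilter, Finset.card_insert_of_notMem (by simp)]
        push_cast
        linarith [hT N (hF hN)]
      · have hfilter : F.filter (· < N + 1) = F.filter (· < N) := by
          ext t
          simp only [Finset.mem_filter]
          grind
        rw [hfilter]
        linarith [hf N.le_succ]
  have card_le (F : Finset ℕ) (hF : ↑F ⊆ T) : (F.card : ℝ) ≤ (f 0 - m) / δ := by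
    rw [le_div_iff₀ hδ]
    have h := telescope F hF (F.sup id + 1)
    have lt_bound : ∀ t ∈ F, t < F.sup id + 1 :=
      fun t ht => Nat.lt_succ_of_le (Finset.le_sup (f := id) ht)
    rw [Finset.filter_true_of_mem lt_bound] at h
    linarith [hm (F.sup id + 1)]
  have finite_T : T.Finite := by
    by_contra hinf
    obtain ⟨k, hk⟩ := exists_nat_gt ((f 0 - m) / δ)
    obtain ⟨F, hF, rfl⟩ := Set.Infinite.exists_subset_card_eq hinf k
    exact hk.not_ge (card_le F hF)
  refine ⟨finite_T, ?_⟩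
  rw [Set.ncard_eq_toFinset_card T finite_T]
  exact card_le _ (by simp)

/-- **greedy active-set rule.** If `c` is differentiable and bounded below,
each active set `S_t` contains every coordinate `i` with `|∂_i c(x_t)| > τ_d`, and each
step achieves the block sufficient decrease
`c(x_{t+1}) ≤ c(x_t) − α ∑_{i ∈ S_t} (∂_i c(x_t))²`, then the set of iterations at which
`‖∇c(x_t)‖_∞ > τ_d` is finite, of cardinality at most `(c(x_0) − inf c)/(α τ_d²)`. -/
theorem active_set_gradient_large_finitely_often
    {n : ℕ} (c : EuclideanSpace ℝ (Fin n) → ℝ)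
    (hc : Differentiable ℝ c) (hbdd : BddBelow (Set.range c))
    (α τd : ℝ) (hα : 0 < α) (hτ : 0 < τd)
    (x : ℕ → EuclideanSpace ℝ (Fin n)) (S : ℕ → Finset (Fin n))
    (hS : ∀ t, ∀ i : Fin n, τd < |gradient c (x t) i| → i ∈ S t)
    (hdec : ∀ t, c (x (t + 1)) ≤ c (x t) - α * ∑ i ∈ S t, (gradient c (x t) i) ^ 2) :
    {t : ℕ | ∃ i : Fin n, τd < |gradient c (x t) i|}.Finite ∧
      (({t : ℕ | ∃ i : Fin n, τd < |gradient c (x t) i|}.ncard : ℝ) ≤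
        (c (x 0) - sInf (Set.range c)) / (α * τd ^ 2)) := by
  have drop_nonneg (t : ℕ) : 0 ≤ α * ∑ i ∈ S t, (gradient c (x t) i) ^ 2 :=
    mul_nonneg hα.le (Finset.sum_nonneg fun _ _ => sq_nonneg _)
  refine finite_and_ncard_le_of_forall_mem_drop (f := fun t => c (x t)) (by positivity)
    (fun t => csInf_le hbdd ⟨x t, rfl⟩)
    (antitone_nat_of_succ_le fun t => by linarith [hdec t, drop_nonneg t]) ?_
  rintro t ⟨i, hi⟩
  have sq_le : τd ^ 2 ≤ ∑ i ∈ S t, (gradient c (x t) i) ^ 2 :=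
    calc τd ^ 2 ≤ |gradient c (x t) i| ^ 2 := by gcongr
      _ = (gradient c (x t) i) ^ 2 := sq_abs _
      _ ≤ _ := Finset.single_le_sum (f := fun i => (gradient c (x t) i) ^ 2)
        (fun _ _ => sq_nonneg _) (hS t i hi)
  linarith [hdec t, mul_le_mul_of_nonneg_left sq_le hα.le]
end

section
/- Let F : ℝⁿ → ℝⁿ be continuously differentiable, let x* satisfy F(x*) = 0 with invertible derivative DF(x*), and fix constants 0 ≤ η_max < t < 1. Then there exists ε > 0 with the following property: for every sequence (x_k) with ‖x_0 − x*‖ ≤ ε and x_{k+1} = x_k + s_k, where each inexact Newton step s_k satisfies the forcing condition ‖F(x_k) + DF(x_k) s_k‖ ≤ η_k ‖F(x_k)‖ for some η_k ≤ η_max, the sequence (x_k) converges to x*, and moreover ‖x_{k+1} − x*‖_* ≤ t ‖x_k − x*‖_* for every k, where ‖y‖_* := ‖DF(x*) y‖. -/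
open Filter Topology

/-- One inexact Newton step contracts the error in the norm `‖A ·‖` by the factor `t`, as soon
as the linearization errors at the current point are small relative to `t - η`. -/
theorem norm_inexact_newton_step_le {E G : Type*} [NormedAddCommGroup E] [NormedSpace ℝ E]
    [NormedAddCommGroup G] [NormedSpace ℝ G] {A B : E →L[ℝ] G} {M γ η t : ℝ} {e s : E} {f : G}
    (hA : ∀ y, ‖y‖ ≤ M * ‖A y‖) (hγ : 0 ≤ γ) (hM : 0 ≤ M) (hη : 0 ≤ η) (ht : t < 1)
    (hsmall : 4 * (γ * M) ≤ t - η) (hf : ‖f - A e‖ ≤ γ * ‖e‖) (hB : ‖B - A‖ ≤ γ)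
    (hres : ‖f + B s‖ ≤ η * ‖f‖) :
    ‖A (e + s)‖ ≤ t * ‖A e‖ := by
  have hg : 0 ≤ γ * M := mul_nonneg hγ hM
  have hlin : ‖f - A e‖ ≤ γ * M * ‖A e‖ :=
    hf.trans (by rw [mul_assoc]; exact mul_le_mul_of_nonneg_left (hA e) hγ)
  have hfnorm : ‖f‖ ≤ (1 + γ * M) * ‖A e‖ := by
    have h := norm_add_le (f - A e) (A e)
    rw [sub_add_cancel] at h
    linarith
  have hs : ‖s‖ ≤ M * (‖A (e + s)‖ + ‖A e‖) := by
    have h := norm_sub_le (e + s) e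
    rw [add_sub_cancel_left] at h
    linarith [hA (e + s), hA e]
  have hBs : ‖(B - A) s‖ ≤ γ * M * (‖A (e + s)‖ + ‖A e‖) :=
    ((B - A).le_of_opNorm_le hB s).trans
      (by rw [mul_assoc]; exact mul_le_mul_of_nonneg_left hs hγ)
  have hsplit : A (e + s) = (f + B s) - (f - A e) - (B - A) s := by
    simp only [map_add, sub_apply]
    abel
  have htri : ‖A (e + s)‖ ≤ ‖f + B s‖ + ‖f - A e‖ + ‖(B - A) s‖ := by
    conv_lhs => rw [hsplit]
    exact (norm_sub_le _ _).trans (by gcongr; exact norm_sub_le _ _)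
  have hηf := mul_le_mul_of_nonneg_left hfnorm hη
  have hbound : (1 - γ * M) * ‖A (e + s)‖ ≤ (2 * (γ * M) + η * (1 + γ * M)) * ‖A e‖ := by
    linarith
  have hcoef : 2 * (γ * M) + η * (1 + γ * M) ≤ (1 - γ * M) * t := by
    nlinarith
  refine le_of_mul_le_mul_left ?_ (show 0 < 1 - γ * M by linarith)
  calc (1 - γ * M) * ‖A (e + s)‖ ≤ (2 * (γ * M) + η * (1 + γ * M)) * ‖A e‖ := hbound
    _ ≤ (1 - γ * M) * t * ‖A e‖ := by gcongr
    _ = (1 - γ * M) * (t * ‖A e‖) := mul_assoc _ _ _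

/-- Near a point, a `C¹` map is uniformly close to its linearization, and so is its derivative. -/
theorem ContDiff.exists_forall_norm_sub_lt_linearization {E G : Type*} [NormedAddCommGroup E]
    [NormedSpace ℝ E] [NormedAddCommGroup G] [NormedSpace ℝ G] {F : E → G}
    (hF : ContDiff ℝ 1 F) (a : E) {γ : ℝ} (hγ : 0 < γ) :
    ∃ δ > 0, ∀ x, ‖x - a‖ < δ →
      ‖F x - F a - fderiv ℝ F a (x - a)‖ ≤ γ * ‖x - a‖ ∧ ‖fderiv ℝ F x - fderiv ℝ F a‖ ≤ γ := by
  have hlin := ((hF.differentiable one_ne_zero a).hasFDerivAt.isLittleO).bound hγ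
  have hcont := (hF.continuous_fderiv one_ne_zero).continuousAt.eventually
    (Metric.closedBall_mem_nhds (fderiv ℝ F a) hγ)
  obtain ⟨δ, hδ, h⟩ := Metric.eventually_nhds_iff.1 (hlin.and hcont)
  refine ⟨δ, hδ, fun x hx => ?_⟩
  obtain ⟨h₁, h₂⟩ := h (by rwa [dist_eq_norm])
  exact ⟨h₁, by rwa [dist_eq_norm] at h₂⟩

/-- An invertible continuous linear endomorphism is bounded below. -/
theorem ContinuousLinearMap.exists_pos_norm_le_of_isUnit {E : Type*} [NormedAddCommGroup E]
    [NormedSpace ℝ E] {A : E →L[ℝ] E} (hA : IsUnit A) : ∃ M > 0, ∀ y, ‖y‖ ≤ M * ‖A y‖ := by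
  obtain ⟨B, hB⟩ := hA.exists_left_inv
  refine ⟨‖B‖ + 1, by positivity, fun y => ?_⟩
  calc ‖y‖ = ‖B (A y)‖ := by rw [← mul_apply_eq_comp, hB, one_apply_eq_self]
    _ ≤ ‖B‖ * ‖A y‖ := B.le_opNorm _
    _ ≤ (‖B‖ + 1) * ‖A y‖ := by gcongr; linarith

/-- **Eisenstat–Walker local linear convergence of inexact Newton.** Let
`F` be `C¹` with `F(x*) = 0` and `DF(x*)` invertible, and fix `0 ≤ η_max < t < 1`. Then
there is `ε > 0` such that any inexact Newton sequence started with `‖x_0 − x*‖ ≤ ε`,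
whose steps satisfy the forcing condition `‖F(x_k) + DF(x_k)s_k‖ ≤ η_k‖F(x_k)‖` with
`η_k ≤ η_max`, converges to `x*` with `‖x_{k+1} − x*‖_* ≤ t‖x_k − x*‖_*`, where
`‖y‖_* = ‖DF(x*)y‖`. -/
theorem inexact_newton_local_linear_convergence
    {n : ℕ} (F : EuclideanSpace ℝ (Fin n) → EuclideanSpace ℝ (Fin n))
    (hF : ContDiff ℝ 1 F) (xstar : EuclideanSpace ℝ (Fin n)) (hroot : F xstar = 0)
    (hinv : IsUnit (fderiv ℝ F xstar))
    (ηmax t : ℝ) (hη0 : 0 ≤ ηmax) (hηt : ηmax < t) (ht1 : t < 1) :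
    ∃ ε > 0, ∀ (x s : ℕ → EuclideanSpace ℝ (Fin n)) (η : ℕ → ℝ),
      ‖x 0 - xstar‖ ≤ ε →
      (∀ k, x (k + 1) = x k + s k) →
      (∀ k, η k ≤ ηmax) →
      (∀ k, ‖F (x k) + fderiv ℝ F (x k) (s k)‖ ≤ η k * ‖F (x k)‖) →
      Tendsto x atTop (𝓝 xstar) ∧
        ∀ k, ‖fderiv ℝ F xstar (x (k + 1) - xstar)‖ ≤
          t * ‖fderiv ℝ F xstar (x k - xstar)‖ := by
  obtain ⟨M, hM, hA⟩ := ContinuousLinearMap.exists_pos_norm_le_of_isUnit hinv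
  have hγ : 0 < (t - ηmax) / (4 * M) := div_pos (sub_pos.2 hηt) (by positivity)
  obtain ⟨δ, hδ, hlocal⟩ := hF.exists_forall_norm_sub_lt_linearization xstar hγ
  set A := fderiv ℝ F xstar
  have ht0 : 0 ≤ t := hη0.trans hηt.le
  refine ⟨δ / (M * (‖A‖ + 1)), by positivity, fun x s η hx0 hx hη hres => ?_⟩
  have hstart : M * ‖A (x 0 - xstar)‖ < δ := by
    have hK : 0 < M * (‖A‖ + 1) := by positivity
    rw [le_div_iff₀ hK] at hx0
    rcases (norm_nonneg (x 0 - xstar)).eq_or_lt' with h0 | h0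
    · simpa [norm_eq_zero.1 h0] using hδ
    · nlinarith [mul_le_mul_of_nonneg_left (A.le_opNorm (x 0 - xstar)) hM.le, mul_pos hM h0]
  have hstep : ∀ k, M * ‖A (x k - xstar)‖ < δ →
      ‖A (x (k + 1) - xstar)‖ ≤ t * ‖A (x k - xstar)‖ := by
    intro k hk
    obtain ⟨h₁, h₂⟩ := hlocal (x k) ((hA _).trans_lt hk)
    rw [hroot, sub_zero] at h₁
    rw [hx k, add_sub_right_comm]
    refine norm_inexact_newton_step_le hA hγ.le hM.le hη0 ht1 (le_of_eq ?_) h₁ h₂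
      ((hres k).trans (mul_le_mul_of_nonneg_right (hη k) (norm_nonneg _)))
    field_simp
  have hclose : ∀ k, M * ‖A (x k - xstar)‖ < δ := by
    intro k
    induction k with
    | zero => exact hstart
    | succ k ih =>
      refine (mul_le_mul_of_nonneg_left ((hstep k ih).trans ?_) hM.le).trans_lt ih
      exact mul_le_of_le_one_left (norm_nonneg _) ht1.le
  have hcontr := fun k => hstep k (hclose k)
  refine ⟨?_, hcontr⟩
  have hgeom : ∀ k, ‖A (x k - xstar)‖ ≤ t ^ k * ‖A (x 0 - xstar)‖ := fun k =>
    le_geom (u := fun k => ‖A (x k - xstar)‖) ht0 k fun j _ => hcontr j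
  rw [tendsto_iff_norm_sub_tendsto_zero]
  refine squeeze_zero (fun _ => norm_nonneg _)
    (fun k => (hA _).trans (mul_le_mul_of_nonneg_left (hgeom k) hM.le)) ?_
  simpa using ((tendsto_pow_atTop_nhds_zero_of_lt_one ht0 ht1).mul_const _).const_mul M
end

section
/- Let F : ℝⁿ → ℝⁿ be continuously differentiable, let x* satisfy F(x*) = 0 with invertible derivative DF(x*), and let (x_k) be a sequence with x_{k+1} = x_k + s_k, where ‖F(x_k) + DF(x_k) s_k‖ ≤ η_k ‖F(x_k)‖ for each k. If x_k → x*, x_k ≠ x* for all k, and the forcing terms satisfy η_k → 0, then the convergence is superlinear: ‖x_{k+1} − x*‖ / ‖x_k − x*‖ → 0 as k → ∞. -/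
open Filter Topology

open Asymptotics

/-- If the linear operators `A k` tend to `B`, then `A k (v k) - B (v k)` is negligible
compared with `v k`. -/
theorem isLittleO_clm_apply_sub {ι E F : Type*} [NormedAddCommGroup E] [NormedSpace ℝ E]
    [NormedAddCommGroup F] [NormedSpace ℝ F] {l : Filter ι} {A : ι → E →L[ℝ] F} {B : E →L[ℝ] F}
    (hA : Tendsto A l (𝓝 B)) (v : ι → E) :
    (fun k => A k (v k) - B (v k)) =o[l] v := by
  refine isLittleO_iff.2 fun c hc => ?_
  filter_upwards [hA (Metric.closedBall_mem_nhds B hc)] with k hk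
  rw [Set.mem_preimage, mem_closedBall_iff_norm] at hk
  exact (A k - B).le_of_opNorm_le hk (v k)

/-- An invertible continuous linear map is bounded below. -/
theorem isBigO_clm_apply_of_isUnit {ι E : Type*} [NormedAddCommGroup E] [NormedSpace ℝ E]
    {B : E →L[ℝ] E} (hB : IsUnit B) (l : Filter ι) (v : ι → E) :
    v =O[l] fun k => B (v k) := by
  obtain ⟨u, rfl⟩ := hB
  simpa [← mul_apply_eq_comp] using
    (↑u⁻¹ : E →L[ℝ] E).isBigO_comp (fun k => (u : E →L[ℝ] E) (v k)) l

/-- One inexact Newton step with vanishing forcing terms reduces the error to a negligible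
fraction of the previous error. -/
theorem inexact_newton_isLittleO {ι E : Type*} [NormedAddCommGroup E] [NormedSpace ℝ E]
    {l : Filter ι} {F : E → E} {a : E} (hF : DifferentiableAt ℝ F a)
    (hF' : ContinuousAt (fderiv ℝ F) a) (hroot : F a = 0) (hinv : IsUnit (fderiv ℝ F a))
    {x s : ι → E} {η : ι → ℝ}
    (hforce : ∀ k, ‖F (x k) + fderiv ℝ F (x k) (s k)‖ ≤ η k * ‖F (x k)‖)
    (hconv : Tendsto x l (𝓝 a)) (hη : Tendsto η l (𝓝 0)) :
    (fun k => x k + s k - a) =o[l] fun k => x k - a := by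
  have hA : Tendsto (fun k => fderiv ℝ F (x k)) l (𝓝 (fderiv ℝ F a)) := hF'.tendsto.comp hconv
  have hFx : (fun k => F (x k)) =O[l] fun k => x k - a := by
    simpa [hroot, Function.comp_def] using hF.hasFDerivAt.isBigO_sub.comp_tendsto hconv
  have hlin : (fun k => F (x k) - fderiv ℝ F a (x k - a)) =o[l] fun k => x k - a := by
    simpa [hroot, Function.comp_def] using hF.hasFDerivAt.isLittleO.comp_tendsto hconv
  have hres : (fun k => F (x k) + fderiv ℝ F (x k) (s k)) =o[l] fun k => x k - a := by
    have hprod : (fun k => η k * ‖F (x k)‖) =o[l] fun k => x k - a := by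
      simpa using (((isLittleO_one_iff ℝ).2 hη).mul_isBigO hFx.norm_norm).norm_right
    exact (IsBigO.of_norm_le hforce).trans_isLittleO hprod
  have hnext : (fun k => fderiv ℝ F (x k) (x k + s k - a)) =o[l] fun k => x k - a := by
    refine ((hres.sub hlin).add (isLittleO_clm_apply_sub hA fun k => x k - a)).congr_left
      fun k => ?_
    simp only [map_sub, map_add]
    abel
  have hbelow := isBigO_clm_apply_of_isUnit hinv l fun k => x k + s k - a
  have hequiv := ((isLittleO_clm_apply_sub hA fun k => x k + s k - a).trans_isBigO
    hbelow).right_isBigO_add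
  simp only [sub_add_cancel] at hequiv
  exact (hbelow.trans hequiv).trans_isLittleO hnext

/-- **Eisenstat–Walker superlinear convergence.** Let `F` be `C¹` with
`F(x*) = 0` and `DF(x*)` invertible, and let `(x_k)` be an inexact Newton sequence,
`x_{k+1} = x_k + s_k` with `‖F(x_k) + DF(x_k)s_k‖ ≤ η_k‖F(x_k)‖`. If `x_k → x*`,
`x_k ≠ x*` for all `k`, and `η_k → 0`, then `‖x_{k+1} − x*‖/‖x_k − x*‖ → 0`. -/
theorem inexact_newton_superlinear_convergence
    {n : ℕ} (F : EuclideanSpace ℝ (Fin n) → EuclideanSpace ℝ (Fin n))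
    (hF : ContDiff ℝ 1 F) (xstar : EuclideanSpace ℝ (Fin n)) (hroot : F xstar = 0)
    (hinv : IsUnit (fderiv ℝ F xstar))
    (x s : ℕ → EuclideanSpace ℝ (Fin n)) (η : ℕ → ℝ)
    (hstep : ∀ k, x (k + 1) = x k + s k)
    (hforce : ∀ k, ‖F (x k) + fderiv ℝ F (x k) (s k)‖ ≤ η k * ‖F (x k)‖)
    (hconv : Tendsto x atTop (𝓝 xstar))
    (hne : ∀ k, x k ≠ xstar)
    (hη : Tendsto η atTop (𝓝 0)) :
    Tendsto (fun k => ‖x (k + 1) - xstar‖ / ‖x k - xstar‖) atTop (𝓝 0) := by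
  have h := inexact_newton_isLittleO (hF.differentiable one_ne_zero xstar)
    (hF.continuous_fderiv one_ne_zero).continuousAt hroot hinv hforce hconv hη
  simpa only [hstep] using h.norm_norm.tendsto_div_nhds_zero
end
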